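/- Let θ be an inner function in the disk algebra setting H_∞(𝔻). For any p ∈ (1, ∞), the model space K_θ = H_p(𝔻) ∩ θz̄·conj(H_p(𝔻)) is contained in H_∞(𝔻) if and only if θ is a rational function (i.e., a finite Blaschke product). -/

import Mathlib

open MeasureTheory Complex Filter Set

noncomputable section

/-- The open unit disk. -/
def Disk : Set ℂ := Metric.ball (0 : ℂ) 1

/-- Radial boundary limit at the boundary point `e^{it}`. -/
def radLim (F : ℂ → ℂ) (t : ℝ) (c : ℂ) : Prop :=
  Filter.Tendsto (fun r : ℝ => F ((r : ℂ) * Complex.exp (t * Complex.I)))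
    (nhdsWithin 1 (Set.Iio 1)) (nhds c)

/-- The Hardy space `H_p(𝔻)`, viewed as a set of boundary functions
`f : ℝ → ℂ` (functions of the angle `t`). -/
def HpDisk (p : ℝ) : Set (ℝ → ℂ) :=
  {f | ∃ F : ℂ → ℂ, DifferentiableOn ℂ F Disk ∧
    (∃ C : ℝ, ∀ r : ℝ, 0 ≤ r → r < 1 →
      (∫ t in Set.Ioc (0 : ℝ) (2 * Real.pi),
        ‖F ((r : ℂ) * Complex.exp (t * Complex.I))‖ ^ p) ≤ C) ∧
    ∀ᵐ t : ℝ, radLim F t (f t)}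

/-- `H_∞(𝔻)` as a set of boundary functions. -/
def HinfDisk : Set (ℝ → ℂ) :=
  {f | ∃ F : ℂ → ℂ, DifferentiableOn ℂ F Disk ∧ (∃ C : ℝ, ∀ z ∈ Disk, ‖F z‖ ≤ C) ∧
    ∀ᵐ t : ℝ, radLim F t (f t)}

/-- `θ` is an inner function on `𝔻` with boundary function `θb`. -/
def InnerDisk (θ : ℂ → ℂ) (θb : ℝ → ℂ) : Prop :=
  DifferentiableOn ℂ θ Disk ∧ (∀ z ∈ Disk, ‖θ z‖ ≤ 1) ∧
  (∀ᵐ t : ℝ, ‖θb t‖ = 1) ∧ (∀ᵐ t : ℝ, radLim θ t (θb t))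

/-- The model space `K_θ = H_p(𝔻) ∩ θ z̄ conj(H_p(𝔻))`, as boundary functions:
`f ∈ K_θ` iff `f ∈ H_p(𝔻)` and `θ̄ f = e^{-it} ḡ` for some `g ∈ H_p(𝔻)`. -/
def KDisk (p : ℝ) (θb : ℝ → ℂ) : Set (ℝ → ℂ) :=
  {f | f ∈ HpDisk p ∧ ∃ g ∈ HpDisk p, ∀ᵐ t : ℝ,
    (starRingEnd ℂ) (θb t) * f t = Complex.exp (-(t * Complex.I)) * (starRingEnd ℂ) (g t)}

/-- `θ` is a finite Blaschke product (equivalently, a rational inner function). -/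
def FiniteBlaschke (θ : ℂ → ℂ) : Prop :=
  ∃ (c : ℂ), ‖c‖ = 1 ∧ ∃ (n : ℕ) (a : Fin n → ℂ), (∀ i, ‖a i‖ < 1) ∧
    ∀ z ∈ Disk, θ z = c * ∏ i, (z - a i) / (1 - (starRingEnd ℂ) (a i) * z)

open scoped Topology ENNReal

/-- `F` is a function in the Hardy space `H_p` with radial boundary function `f`. -/
def HasHpBoundary (p : ℝ) (F : ℂ → ℂ) (f : ℝ → ℂ) : Prop :=
  DifferentiableOn ℂ F Disk ∧
    (∃ C : ℝ, ∀ r : ℝ, 0 ≤ r → r < 1 →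
      (∫ t in Set.Ioc (0 : ℝ) (2 * Real.pi),
        ‖F ((r : ℂ) * Complex.exp (t * Complex.I))‖ ^ p) ≤ C) ∧
    ∀ᵐ t : ℝ, radLim F t (f t)

lemma mem_disk {z : ℂ} : z ∈ Disk ↔ ‖z‖ < 1 := by simp [Disk]

lemma isOpen_disk : IsOpen Disk := Metric.isOpen_ball

lemma norm_ofReal_mul_exp {r : ℝ} (hr : 0 ≤ r) (t : ℝ) :
    ‖(r : ℂ) * Complex.exp (t * Complex.I)‖ = r := by
  rw [norm_mul, Complex.norm_exp_ofReal_mul_I, mul_one, Complex.norm_real, Real.norm_of_nonneg hr]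

lemma ofReal_mul_exp_mem_disk {r : ℝ} (hr : 0 ≤ r) (hr1 : r < 1) (t : ℝ) :
    (r : ℂ) * Complex.exp (t * Complex.I) ∈ Disk := by
  rw [mem_disk, norm_ofReal_mul_exp hr]; exact hr1

lemma continuous_comp_circle {F : ℂ → ℂ} (hF : ContinuousOn F Disk) {r : ℝ} (hr : 0 ≤ r)
    (hr1 : r < 1) : Continuous fun t : ℝ => F ((r : ℂ) * Complex.exp (t * Complex.I)) :=
  hF.comp_continuous (by fun_prop) fun t => ofReal_mul_exp_mem_disk hr hr1 t

lemma eventually_mem_Ioo : ∀ᶠ r : ℝ in 𝓝[<] 1, r ∈ Set.Ioo (0 : ℝ) 1 :=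
  Ioo_mem_nhdsLT one_pos

/-- Radial limits at points where `F` extends continuously. -/
lemma radLim_of_continuousAt {F G : ℂ → ℂ} {t : ℝ} (h : Set.EqOn F G Disk)
    (hG : ContinuousAt G (Complex.exp (t * Complex.I))) :
    radLim F t (G (Complex.exp (t * Complex.I))) := by
  have h1 : Tendsto (fun r : ℝ => (r : ℂ) * Complex.exp (t * Complex.I)) (𝓝[<] 1)
      (𝓝 (Complex.exp (t * Complex.I))) := by
    have : Continuous fun r : ℝ => (r : ℂ) * Complex.exp (t * Complex.I) := by fun_prop
    simpa using (this.tendsto 1).mono_left nhdsWithin_le_nhds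
  refine (hG.tendsto.comp h1).congr' ?_
  filter_upwards [eventually_mem_Ioo] with r hr
  exact (h (ofReal_mul_exp_mem_disk hr.1.le hr.2 t)).symm

lemma radLim_const (c : ℂ) (t : ℝ) : radLim (fun _ => c) t c := tendsto_const_nhds

lemma radLim_mul {F G : ℂ → ℂ} {t : ℝ} {a b : ℂ} (hF : radLim F t a) (hG : radLim G t b) :
    radLim (fun z => F z * G z) t (a * b) := Tendsto.mul hF hG

lemma integral_comp_circle_mul_exp_eq_zero {F : ℂ → ℂ} (hF : DifferentiableOn ℂ F Disk) {r : ℝ}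
    (hr : 0 < r) (hr1 : r < 1) (n : ℕ) :
    ∫ t in Set.Ioc (0 : ℝ) (2 * Real.pi), F ((r : ℂ) * Complex.exp (t * Complex.I)) *
      Complex.exp (((n + 1 : ℕ) : ℂ) * (t * Complex.I)) = 0 := by
  have hsub : Metric.closedBall (0 : ℂ) r ⊆ Disk := Metric.closedBall_subset_ball hr1
  have h : ∮ z in C(0, r), z ^ n * F z = 0 := by
    apply DiffContOnCl.circleIntegral_eq_zero hr.le
    apply DifferentiableOn.diffContOnCl_ball (U := Disk) _ hsub
    exact (differentiableOn_id.pow n).mul hF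
  rw [circleIntegral, intervalIntegral.integral_of_le (by positivity)] at h
  have hr' : (r : ℂ) ≠ 0 := by exact_mod_cast hr.ne'
  have hc : (r : ℂ) ^ (n + 1) * Complex.I ≠ 0 :=
    mul_ne_zero (pow_ne_zero _ hr') Complex.I_ne_zero
  rw [← mul_right_inj' hc, mul_zero, ← MeasureTheory.integral_const_mul, ← h]
  congr 1
  ext t
  simp only [deriv_circleMap, circleMap, zero_add, smul_eq_mul, Complex.exp_nat_mul]
  ring

lemma exists_coeff {F : ℂ → ℂ} (hF : DifferentiableOn ℂ F Disk) :
    ∃ a : ℕ → ℂ, (∀ z ∈ Disk, HasSum (fun n => a n * z ^ n) (F z)) ∧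
      ∀ r : ℝ, 0 < r → r < 1 → ∀ n : ℕ,
        ∫ t in Set.Ioc (0 : ℝ) (2 * Real.pi), F ((r : ℂ) * Complex.exp (t * Complex.I)) *
          Complex.exp (-((n : ℂ) * (t * Complex.I))) = 2 * Real.pi * r ^ n * a n := by
  have hps : ∀ r : ℝ, 0 < r → r < 1 →
      HasFPowerSeriesOnBall F (cauchyPowerSeries F 0 r) 0 (ENNReal.ofReal r) := by
    intro r hr hr1
    have h := DifferentiableOn.hasFPowerSeriesOnBall (f := F) (c := 0) (R := r.toNNReal)
      (hF.mono (by
        rw [Real.coe_toNNReal _ hr.le]; exact Metric.closedBall_subset_ball hr1)) (by simpa using hr)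
    rwa [Real.coe_toNNReal _ hr.le] at h
  have heq : ∀ r : ℝ, 0 < r → r < 1 →
      cauchyPowerSeries F 0 r = cauchyPowerSeries F 0 (1 / 2) := fun r hr hr1 =>
    (hps r hr hr1).hasFPowerSeriesAt.eq_formalMultilinearSeries
      (hps (1 / 2) (by norm_num) (by norm_num)).hasFPowerSeriesAt
  refine ⟨fun n => (cauchyPowerSeries F 0 (1 / 2)).coeff n, ?_, ?_⟩
  · intro z hz
    rw [mem_disk] at hz
    obtain ⟨r, hr1, hr2⟩ := exists_between hz
    have hr0 : 0 < r := (norm_nonneg z).trans_lt hr1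
    have := (hps r hr0 hr2).hasSum (y := z) (by
      simp only [Metric.mem_eball, edist_zero_right]
      rw [← ofReal_norm]
      exact (ENNReal.ofReal_lt_ofReal_iff hr0).2 hr1)
    rw [heq r hr0 hr2] at this
    simpa [FormalMultilinearSeries.apply_eq_pow_smul_coeff, mul_comm] using this
  · intro r hr hr1 n
    rw [← heq r hr hr1]
    have hr' : (r : ℂ) ≠ 0 := by exact_mod_cast hr.ne'
    have hpi : (Real.pi : ℂ) ≠ 0 := by exact_mod_cast Real.pi_ne_zero
    simp only [FormalMultilinearSeries.coeff, cauchyPowerSeries,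
      ContinuousMultilinearMap.mkPiRing_apply, Pi.one_apply, Finset.prod_const_one, one_smul]
    rw [circleIntegral, intervalIntegral.integral_of_le (by positivity), smul_eq_mul,
      ← mul_assoc, ← MeasureTheory.integral_const_mul]
    congr 1
    ext t
    have he := Complex.exp_ne_zero (t * Complex.I)
    simp only [deriv_circleMap, circleMap, zero_add, sub_zero, smul_eq_mul, Complex.exp_neg,
      Complex.exp_nat_mul, mul_inv, mul_pow, inv_pow]
    field_simp

lemma uniformIntegrable_one_of_eLpNorm_le {α : Type*} [MeasurableSpace α] {μ : Measure α}
    [IsFiniteMeasure μ] {p : ℝ} (hp : 1 < p) {f : ℕ → α → ℂ}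
    (hf : ∀ n, AEStronglyMeasurable (f n) μ) {K : ℝ} (hK : 0 < K)
    (hb : ∀ n, eLpNorm (f n) (ENNReal.ofReal p) μ ≤ ENNReal.ofReal K) :
    UniformIntegrable f 1 μ := by
  have hp0 : 0 < p := by linarith
  have hp1 : (1 : ℝ≥0∞) ≤ ENNReal.ofReal p := by simpa using hp.le
  have hs : 0 < 1 - 1 / p := by
    have : 1 / p < 1 := by rw [div_lt_one hp0]; exact hp
    linarith
  have key : ∀ n (s : Set α), eLpNorm (f n) 1 (μ.restrict s) ≤
      ENNReal.ofReal K * μ s ^ (1 - 1 / p) := by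
    intro n s
    have := eLpNorm_le_eLpNorm_mul_rpow_measure_univ hp1 ((hf n).restrict (s := s))
    rw [ENNReal.toReal_ofReal hp0.le, Measure.restrict_apply_univ] at this
    simp only [ENNReal.toReal_one, div_one] at this
    refine this.trans ?_
    gcongr
    exact (eLpNorm_restrict_le _ _ _ _).trans (hb n)
  refine ⟨hf, ?_, ?_⟩
  · intro ε hε
    refine ⟨(ε / K) ^ (1 - 1 / p)⁻¹, by positivity, fun n s hms hs' => ?_⟩
    rw [eLpNorm_indicator_eq_eLpNorm_restrict hms]
    calc _ ≤ ENNReal.ofReal K * μ s ^ (1 - 1 / p) := key n s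
      _ ≤ ENNReal.ofReal K * ENNReal.ofReal ((ε / K) ^ (1 - 1 / p)⁻¹) ^ (1 - 1 / p) := by gcongr
      _ = ENNReal.ofReal ε := by
        rw [ENNReal.ofReal_rpow_of_nonneg (by positivity) hs.le,
          ← Real.rpow_mul (by positivity), inv_mul_cancel₀ hs.ne', Real.rpow_one,
          ← ENNReal.ofReal_mul hK.le, mul_div_cancel₀ _ hK.ne']
  · refine ⟨(ENNReal.ofReal K * μ Set.univ ^ (1 - 1 / p)).toNNReal, fun n => ?_⟩
    rw [ENNReal.coe_toNNReal
      (ENNReal.mul_ne_top ENNReal.ofReal_ne_top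
        (ENNReal.rpow_ne_top_of_nonneg hs.le (measure_ne_top _ _)))]
    simpa using key n Set.univ

lemma tendsto_radius : Tendsto (fun m : ℕ => (1 : ℝ) - 1 / ((m : ℝ) + 2)) atTop (𝓝[<] 1) := by
  rw [tendsto_nhdsWithin_iff]
  constructor
  · have h : Tendsto (fun m : ℕ => (1 : ℝ) / ((m : ℝ) + 2)) atTop (𝓝 0) :=
      Tendsto.div_atTop tendsto_const_nhds
        (tendsto_atTop_add_const_right _ _ tendsto_natCast_atTop_atTop)
    simpa using h.const_sub 1
  · filter_upwards with m
    have : (0 : ℝ) < 1 / ((m : ℝ) + 2) := by positivity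
    simp only [Set.mem_Iio]; linarith

lemma radius_mem (m : ℕ) : (1 : ℝ) - 1 / ((m : ℝ) + 2) ∈ Set.Ioo (0 : ℝ) 1 := by
  have h2 : (1 : ℝ) / ((m : ℝ) + 2) < 1 := by
    rw [div_lt_one (by positivity)]; linarith [Nat.cast_nonneg (α := ℝ) m]
  have : (0 : ℝ) < 1 / ((m : ℝ) + 2) := by positivity
  constructor <;> linarith

/-- The circular means of an `H_p` function against a continuous unimodular function converge to
the corresponding mean of its boundary function. -/
lemma HasHpBoundary.tendsto_integral {p : ℝ} (hp : 1 < p) {F : ℂ → ℂ} {f : ℝ → ℂ}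
    (h : HasHpBoundary p F f) {φ : ℝ → ℂ} (hφ : Continuous φ) (hφ1 : ∀ t, ‖φ t‖ = 1) :
    Tendsto (fun m : ℕ => ∫ t in Set.Ioc (0 : ℝ) (2 * Real.pi),
        F (((1 - 1 / ((m : ℝ) + 2) : ℝ) : ℂ) * Complex.exp (t * Complex.I)) * φ t) atTop
      (𝓝 (∫ t in Set.Ioc (0 : ℝ) (2 * Real.pi), f t * φ t)) := by
  obtain ⟨hF, ⟨C, hC⟩, hlim⟩ := h
  have hp0 : 0 < p := by linarith
  set μ : Measure ℝ := volume.restrict (Set.Ioc (0 : ℝ) (2 * Real.pi)) with hμ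
  set g : ℕ → ℝ → ℂ := fun m t =>
    F (((1 - 1 / ((m : ℝ) + 2) : ℝ) : ℂ) * Complex.exp (t * Complex.I)) * φ t with hg
  have hgc : ∀ m, Continuous (g m) := fun m =>
    (continuous_comp_circle hF.continuousOn (radius_mem m).1.le (radius_mem m).2).mul hφ
  have hgm : ∀ m, AEStronglyMeasurable (g m) μ := fun m => (hgc m).aestronglyMeasurable
  have hmem : ∀ m, MemLp (g m) (ENNReal.ofReal p) μ := by
    intro m
    obtain ⟨M, hM⟩ := (isCompact_Icc (a := (0 : ℝ)) (b := 2 * Real.pi)).exists_bound_of_continuousOn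
      (hgc m).continuousOn
    refine MemLp.of_bound (hgm m) M ?_
    filter_upwards [ae_restrict_mem measurableSet_Ioc] with t ht
    exact hM t (Set.Ioc_subset_Icc_self ht)
  have hbd : ∀ m, eLpNorm (g m) (ENNReal.ofReal p) μ ≤
      ENNReal.ofReal ((|C| + 1) ^ p⁻¹) := by
    intro m
    rw [(hmem m).eLpNorm_eq_integral_rpow_norm (by simpa using hp0) ENNReal.ofReal_ne_top,
      ENNReal.toReal_ofReal hp0.le]
    gcongr
    have := hC _ (radius_mem m).1.le (radius_mem m).2
    simp only [hg, norm_mul, hφ1, mul_one]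
    exact this.trans ((le_abs_self C).trans (by linarith))
  have hui := uniformIntegrable_one_of_eLpNorm_le hp hgm (by positivity) hbd
  have hae : ∀ᵐ t ∂μ, Tendsto (fun m => g m t) atTop (𝓝 (f t * φ t)) := by
    filter_upwards [ae_restrict_of_ae hlim] with t ht
    exact (ht.comp tendsto_radius).mul_const _
  have hL1 := tendsto_Lp_finite_of_tendsto_ae le_rfl ENNReal.one_ne_top hgm
    (memLp_one_iff_integrable.2 (hui.integrable_of_ae_tendsto hae)) hui.2.1 hae
  exact tendsto_integral_of_L1' _ (hui.integrable_of_ae_tendsto hae).aestronglyMeasurable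
    (Eventually.of_forall fun m => (hmem m).integrable (by simpa using hp.le)) hL1

lemma norm_exp_intCast_mul (n : ℤ) (t : ℝ) : ‖Complex.exp ((n : ℂ) * (t * Complex.I))‖ = 1 := by
  have : (n : ℂ) * (t * Complex.I) = ((n * t : ℝ) : ℂ) * Complex.I := by push_cast; ring
  rw [this, Complex.norm_exp_ofReal_mul_I]

/-- The Fourier coefficients of negative index of an `H_p` boundary function vanish. -/
lemma HasHpBoundary.integral_mul_exp_eq_zero {p : ℝ} (hp : 1 < p) {F : ℂ → ℂ} {f : ℝ → ℂ}
    (h : HasHpBoundary p F f) (n : ℕ) :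
    ∫ t in Set.Ioc (0 : ℝ) (2 * Real.pi),
      f t * Complex.exp (((n + 1 : ℕ) : ℂ) * (t * Complex.I)) = 0 := by
  have h1 := h.tendsto_integral hp
    (φ := fun t => Complex.exp (((n + 1 : ℕ) : ℂ) * (t * Complex.I))) (by fun_prop)
    fun t => by simpa using norm_exp_intCast_mul (n + 1 : ℕ) t
  refine tendsto_nhds_unique h1 ?_
  simp_rw [fun m : ℕ => integral_comp_circle_mul_exp_eq_zero h.1 (radius_mem m).1 (radius_mem m).2 n]
  exact tendsto_const_nhds

/-- The Taylor coefficients of an `H_p` function are the Fourier coefficients of its boundary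
function. -/
lemma HasHpBoundary.exists_coeff {p : ℝ} (hp : 1 < p) {F : ℂ → ℂ} {f : ℝ → ℂ}
    (h : HasHpBoundary p F f) :
    ∃ a : ℕ → ℂ, (∀ z ∈ Disk, HasSum (fun n => a n * z ^ n) (F z)) ∧
      ∀ n : ℕ, ∫ t in Set.Ioc (0 : ℝ) (2 * Real.pi),
        f t * Complex.exp (-((n : ℂ) * (t * Complex.I))) = 2 * Real.pi * a n := by
  obtain ⟨a, ha, hint⟩ := _root_.exists_coeff h.1
  refine ⟨a, ha, fun n => ?_⟩
  have h1 := h.tendsto_integral hp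
    (φ := fun t => Complex.exp (-((n : ℂ) * (t * Complex.I)))) (by fun_prop)
    fun t => by simpa using norm_exp_intCast_mul (-n : ℤ) t
  refine tendsto_nhds_unique h1 ?_
  simp_rw [fun m : ℕ => hint _ (radius_mem m).1 (radius_mem m).2 n]
  have h2 : Tendsto (fun m : ℕ => (((1 - 1 / ((m : ℝ) + 2) : ℝ) : ℂ))) atTop (𝓝 1) := by
    simpa [Function.comp_def] using (Complex.continuous_ofReal.tendsto 1).comp
      (tendsto_radius.mono_right nhdsWithin_le_nhds)
  simpa using ((h2.pow n).const_mul (2 * Real.pi : ℂ)).mul_const (a n)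

lemma HasHpBoundary.eqOn {p q : ℝ} (hp : 1 < p) (hq : 1 < q) {F G : ℂ → ℂ} {f : ℝ → ℂ}
    (hF : HasHpBoundary p F f) (hG : HasHpBoundary q G f) : Set.EqOn F G Disk := by
  obtain ⟨a, ha, ha'⟩ := hF.exists_coeff hp
  obtain ⟨b, hb, hb'⟩ := hG.exists_coeff hq
  have hpi : (2 * Real.pi : ℂ) ≠ 0 := by exact_mod_cast Real.two_pi_pos.ne'
  have hab : a = b := by
    ext n
    exact mul_left_cancel₀ hpi ((ha' n).symm.trans (hb' n))
  intro z hz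
  exact (ha z hz).unique (hab ▸ hb z hz)

lemma setIntegral_Ioc_le_of_le {g : ℝ → ℝ} {M : ℝ} (hg : Continuous g) (h : ∀ t, g t ≤ M) :
    ∫ t in Set.Ioc (0 : ℝ) (2 * Real.pi), g t ≤ 2 * Real.pi * M := by
  refine (setIntegral_mono_on (g := fun _ => M) ?_
    (integrableOn_const measure_Ioc_lt_top.ne) measurableSet_Ioc
    fun t _ => h t).trans ?_
  · exact (hg.integrableOn_Icc).mono_set Set.Ioc_subset_Icc_self
  · simp [Real.two_pi_pos.le]

/-- Multiplication by a bounded holomorphic function. -/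
lemma HasHpBoundary.mul {p : ℝ} (hp : 0 < p) {F Q : ℂ → ℂ} {f q : ℝ → ℂ}
    (hF : HasHpBoundary p F f) (hQ : DifferentiableOn ℂ Q Disk) {M : ℝ}
    (hM : ∀ z ∈ Disk, ‖Q z‖ ≤ M) (hq : ∀ᵐ t : ℝ, radLim Q t (q t)) :
    HasHpBoundary p (fun z => F z * Q z) (fun t => f t * q t) := by
  obtain ⟨hF, ⟨C, hC⟩, hlim⟩ := hF
  have hM0 : 0 ≤ M := (norm_nonneg _).trans (hM 0 (by simp [mem_disk]))
  refine ⟨hF.mul hQ, ⟨C * M ^ p, fun r hr hr1 => ?_⟩, ?_⟩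
  · have hcF := continuous_comp_circle hF.continuousOn hr hr1
    have hcQ := continuous_comp_circle hQ.continuousOn hr hr1
    have hint : ∀ g : ℝ → ℝ, Continuous g →
        IntegrableOn g (Set.Ioc (0 : ℝ) (2 * Real.pi)) := fun g hg =>
      hg.integrableOn_Icc.mono_set Set.Ioc_subset_Icc_self
    calc _ ≤ ∫ t in Set.Ioc (0 : ℝ) (2 * Real.pi),
          ‖F ((r : ℂ) * Complex.exp (t * Complex.I))‖ ^ p * M ^ p := by
          refine setIntegral_mono (hint _ ?_) (hint _ ?_) fun t => ?_
          · exact (hcF.mul hcQ).norm.rpow_const fun _ => Or.inr hp.le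
          · exact (hcF.norm.rpow_const fun _ => Or.inr hp.le).mul continuous_const
          · simp only [norm_mul]
            rw [Real.mul_rpow (norm_nonneg _) (norm_nonneg _)]
            gcongr
            exact hM _ (ofReal_mul_exp_mem_disk hr hr1 t)
      _ ≤ C * M ^ p := by
          rw [integral_mul_const]
          gcongr
          exact hC r hr hr1
  · filter_upwards [hlim, hq] with t h1 h2 using radLim_mul h1 h2

/-- Bounded holomorphic functions belong to every Hardy space. -/
lemma hasHpBoundary_of_bounded {p : ℝ} (hp : 0 < p) {F : ℂ → ℂ} {f : ℝ → ℂ}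
    (hF : DifferentiableOn ℂ F Disk) {M : ℝ} (hM : ∀ z ∈ Disk, ‖F z‖ ≤ M)
    (hf : ∀ᵐ t : ℝ, radLim F t (f t)) : HasHpBoundary p F f := by
  have h1 : HasHpBoundary p (fun _ => 1) (fun _ => 1) := by
    refine ⟨differentiableOn_const _, ⟨2 * Real.pi * 1, fun r _ _ => ?_⟩,
      ae_of_all _ fun t => radLim_const 1 t⟩
    exact setIntegral_Ioc_le_of_le (by simpa using continuous_const) (by simp)
  simpa using h1.mul hp hF hM hf

lemma eqOn_polynomial_of_integral_eq_zero {p : ℝ} (hp : 1 < p) {F : ℂ → ℂ} {f : ℝ → ℂ}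
    (h : HasHpBoundary p F f) (n : ℕ)
    (h0 : ∀ k : ℕ, ∫ t in Set.Ioc (0 : ℝ) (2 * Real.pi),
      f t * Complex.exp (-(((n + k : ℕ) : ℂ) * (t * Complex.I))) = 0) :
    ∃ a : ℕ → ℂ, ∀ z ∈ Disk, F z = ∑ m ∈ Finset.range n, a m * z ^ m := by
  obtain ⟨a, ha, hint⟩ := h.exists_coeff hp
  refine ⟨a, fun z hz => (ha z hz).unique (hasSum_sum_of_ne_finset_zero fun m hm => ?_)⟩
  obtain ⟨k, rfl⟩ := Nat.exists_eq_add_of_le (not_lt.1 (Finset.mem_range.not.1 hm))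
  have hpi : (2 * Real.pi : ℂ) ≠ 0 := by exact_mod_cast Real.two_pi_pos.ne'
  have : a (n + k) = 0 := by
    have := (hint (n + k)).symm.trans (h0 k)
    exact (mul_eq_zero.1 this).resolve_left hpi
  simp [this]

lemma one_sub_norm_le_norm_one_sub_conj_mul {a z : ℂ} (hz : ‖z‖ ≤ 1) :
    1 - ‖a‖ ≤ ‖1 - (starRingEnd ℂ) a * z‖ := by
  have h1 := norm_sub_norm_le (1 : ℂ) ((starRingEnd ℂ) a * z)
  have h2 : ‖(starRingEnd ℂ) a * z‖ ≤ ‖a‖ := by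
    rw [norm_mul, RCLike.norm_conj]
    exact mul_le_of_le_one_right (norm_nonneg _) hz
  rw [norm_one] at h1
  linarith

lemma norm_one_sub_conj_mul_pos {a z : ℂ} (ha : ‖a‖ < 1) (hz : ‖z‖ ≤ 1) :
    0 < ‖1 - (starRingEnd ℂ) a * z‖ :=
  (sub_pos.2 ha).trans_le (one_sub_norm_le_norm_one_sub_conj_mul hz)

lemma one_sub_conj_mul_ne_zero {a z : ℂ} (ha : ‖a‖ < 1) (hz : ‖z‖ ≤ 1) :
    1 - (starRingEnd ℂ) a * z ≠ 0 :=
  norm_pos_iff.1 (norm_one_sub_conj_mul_pos ha hz)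

lemma kDisk_subset_of_finiteBlaschke {p : ℝ} (hp : 1 < p) {θ : ℂ → ℂ} {θb : ℝ → ℂ}
    (hθ : InnerDisk θ θb) (hB : FiniteBlaschke θ) : KDisk p θb ⊆ HinfDisk := by
  obtain ⟨-, -, hθ1, hθlim⟩ := hθ
  obtain ⟨c, hc, n, a, ha, hθa⟩ := hB
  have hp0 : 0 < p := by linarith
  rintro f ⟨⟨F, hF⟩, g, ⟨G, hG⟩, hfg⟩
  change HasHpBoundary p F f at hF
  change HasHpBoundary p G g at hG
  set Q : ℂ → ℂ := fun z => ∏ i, (1 - (starRingEnd ℂ) (a i) * z) with hQ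
  have hQd : Differentiable ℂ Q := by
    apply Differentiable.fun_finsetProd
    intro i _
    fun_prop
  have hQne : ∀ z : ℂ, ‖z‖ ≤ 1 → Q z ≠ 0 := fun z hz =>
    Finset.prod_ne_zero_iff.2 fun i _ => one_sub_conj_mul_ne_zero (ha i) hz
  have hQb : ∀ z ∈ Disk, ‖Q z‖ ≤ 2 ^ n := by
    intro z hz
    rw [mem_disk] at hz
    calc ‖Q z‖ = ∏ i, ‖1 - (starRingEnd ℂ) (a i) * z‖ := norm_prod _ _
      _ ≤ ∏ _i : Fin n, (2 : ℝ) := by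
        refine Finset.prod_le_prod (fun _ _ => norm_nonneg _) fun i _ => ?_
        refine (norm_sub_le _ _).trans ?_
        rw [norm_one, norm_mul, RCLike.norm_conj]
        nlinarith [norm_nonneg z, norm_nonneg (a i), ha i]
      _ = 2 ^ n := by simp
  have hQlim : ∀ᵐ t : ℝ, radLim Q t (Q (Complex.exp (t * Complex.I))) := ae_of_all _ fun t =>
    radLim_of_continuousAt (fun _ _ => rfl) hQd.continuous.continuousAt
  have hFQ := hF.mul hp0 hQd.differentiableOn hQb hQlim
  have hGQ := hG.mul hp0 hQd.differentiableOn hQb hQlim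
  have hbdry : ∀ᵐ t : ℝ, f t * Q (Complex.exp (t * Complex.I)) =
      c * Complex.exp (t * Complex.I) ^ n * (Complex.exp (t * Complex.I))⁻¹ *
        (starRingEnd ℂ) (g t * Q (Complex.exp (t * Complex.I))) := by
    filter_upwards [hθ1, hθlim, hfg] with t h1 h2 h3
    set e := Complex.exp (t * Complex.I) with he
    have hen : ‖e‖ = 1 := Complex.norm_exp_ofReal_mul_I t
    have he0 : e ≠ 0 := Complex.exp_ne_zero _
    have hee : (starRingEnd ℂ) e = e⁻¹ := by
      rw [Complex.inv_def, Complex.normSq_eq_norm_sq, hen]; simp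
    have hcont : ContinuousAt
        (fun z => c * ∏ i, (z - a i) / (1 - (starRingEnd ℂ) (a i) * z)) e := by
      refine continuousAt_const.mul (tendsto_finsetProd _ fun i _ => ?_)
      refine ContinuousAt.div (by fun_prop) (by fun_prop) ?_
      exact one_sub_conj_mul_ne_zero (ha i) hen.le
    have hθe : θb t = c * ∏ i, (e - a i) / (1 - (starRingEnd ℂ) (a i) * e) :=
      tendsto_nhds_unique h2 (radLim_of_continuousAt hθa hcont)
    have hP : ∏ i, (e - a i) = e ^ n * (starRingEnd ℂ) (Q e) := by
      have : e ^ n = ∏ _i : Fin n, e := by simp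
      rw [this, hQ]
      simp only [map_prod]
      rw [← Finset.prod_mul_distrib]
      refine Finset.prod_congr rfl fun i _ => ?_
      simp only [map_sub, map_one, map_mul, Complex.conj_conj, hee]
      field_simp
    rw [Finset.prod_div_distrib, hP] at hθe
    have hQe : Q e ≠ 0 := hQne e hen.le
    have hθθ : θb t * (starRingEnd ℂ) (θb t) = 1 := by
      rw [Complex.mul_conj, Complex.normSq_eq_norm_sq, h1]; simp
    have hfe : f t = θb t * (e⁻¹ * (starRingEnd ℂ) (g t)) := by
      rw [he, ← Complex.exp_neg, ← h3, ← mul_assoc, hθθ, one_mul]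
    have hθQ : θb t * Q e = c * (e ^ n * (starRingEnd ℂ) (Q e)) := by
      rw [hθe]; exact by rw [mul_assoc, div_mul_cancel₀ _ hQe]
    rw [hfe, map_mul]
    linear_combination (e⁻¹ * (starRingEnd ℂ) (g t)) * hθQ
  obtain ⟨b, hb⟩ := eqOn_polynomial_of_integral_eq_zero hp hFQ n fun k => by
    have hz := congrArg (starRingEnd ℂ) (hGQ.integral_mul_exp_eq_zero hp k)
    rw [map_zero, ← integral_conj] at hz
    rw [← mul_zero c, ← hz, ← MeasureTheory.integral_const_mul]
    refine integral_congr_ae (ae_restrict_of_ae ?_)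
    filter_upwards [hbdry] with t ht
    have hen : ‖Complex.exp (t * Complex.I)‖ = 1 := Complex.norm_exp_ofReal_mul_I t
    have he0 := Complex.exp_ne_zero (t * Complex.I)
    have hee : (starRingEnd ℂ) (Complex.exp (t * Complex.I)) =
        (Complex.exp (t * Complex.I))⁻¹ := by
      rw [Complex.inv_def, Complex.normSq_eq_norm_sq, hen]; simp
    simp only [ht, Complex.exp_neg, Complex.exp_nat_mul]
    rw [map_mul _ (g t * _) (_ ^ _), map_pow, hee, inv_pow]
    field_simp
    ring
  refine ⟨F, hF.1, ⟨(∑ m ∈ Finset.range n, ‖b m‖) / ∏ i, (1 - ‖a i‖), fun z hz => ?_⟩, hF.2.2⟩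
  have hz1 : ‖z‖ ≤ 1 := (mem_disk.1 hz).le
  have hpos : 0 < ∏ i, (1 - ‖a i‖) := Finset.prod_pos fun i _ => sub_pos.2 (ha i)
  rw [le_div_iff₀ hpos]
  calc ‖F z‖ * ∏ i, (1 - ‖a i‖) ≤ ‖F z‖ * ‖Q z‖ := by
        gcongr
        rw [hQ, norm_prod]
        exact Finset.prod_le_prod (fun i _ => (sub_pos.2 (ha i)).le)
          fun i _ => one_sub_norm_le_norm_one_sub_conj_mul hz1
    _ = ‖∑ m ∈ Finset.range n, b m * z ^ m‖ := by rw [← norm_mul, hb z hz]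
    _ ≤ ∑ m ∈ Finset.range n, ‖b m‖ := by
        refine norm_sum_le_of_le _ fun m _ => ?_
        rw [norm_mul, norm_pow]
        exact mul_le_of_le_one_right (norm_nonneg _) (pow_le_one₀ (norm_nonneg _) hz1)

/-- The modulus of `g` tends to `1` at every point of the unit circle. -/
def TendstoUnimodular (g : ℂ → ℂ) : Prop :=
  ∀ ζ : ℂ, ‖ζ‖ = 1 → Tendsto (fun z => ‖g z‖) (𝓝[Disk] ζ) (𝓝 1)

lemma nhdsWithin_disk_neBot {ζ : ℂ} (hζ : ‖ζ‖ = 1) : (𝓝[Disk] ζ).NeBot := by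
  rw [← mem_closure_iff_nhdsWithin_neBot, Disk, closure_ball _ one_ne_zero]
  simp [hζ]

open Classical in
lemma TendstoUnimodular.continuousOn {g : ℂ → ℂ} (hg : ContinuousOn g Disk)
    (h : TendstoUnimodular g) :
    ContinuousOn (fun z => if z ∈ Disk then ‖g z‖ else 1) (Metric.closedBall (0 : ℂ) 1) := by
  intro ζ hζ
  rw [mem_closedBall_zero_iff] at hζ
  rcases hζ.lt_or_eq with h1 | h1
  · have hD : ζ ∈ Disk := mem_disk.2 h1
    have hn := isOpen_disk.mem_nhds hD
    refine ContinuousAt.continuousWithinAt ?_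
    refine (hg.continuousAt hn).norm.congr ?_
    filter_upwards [hn] with z hz
    rw [if_pos hz]
  · have hD : ζ ∉ Disk := by rw [mem_disk, h1]; exact lt_irrefl _
    rw [ContinuousWithinAt, if_neg hD]
    refine Tendsto.if ?_ tendsto_const_nhds
    refine (h ζ h1).mono_left ?_
    rw [nhdsWithin, nhdsWithin, inf_assoc, inf_principal]
    gcongr
    exact fun z hz => hz.2

/-- The maximum principle for functions of unimodular boundary values. -/
lemma TendstoUnimodular.norm_le_one {g : ℂ → ℂ} (hg : DifferentiableOn ℂ g Disk)
    (h : TendstoUnimodular g) {z : ℂ} (hz : z ∈ Disk) : ‖g z‖ ≤ 1 := by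
  classical
  by_contra! hlt
  obtain ⟨w, hw, hmax⟩ := (isCompact_closedBall (0 : ℂ) 1).exists_isMaxOn
    ⟨0, by simp⟩ (h.continuousOn hg.continuousOn)
  have hle : ∀ u ∈ Disk, ‖g u‖ ≤ if w ∈ Disk then ‖g w‖ else 1 := fun u hu => by
    have := hmax (Metric.ball_subset_closedBall hu)
    simpa only [Set.mem_ofPred_eq, if_pos hu] using this
  have hwD : w ∈ Disk := by
    by_contra hwD
    have := hle z hz
    rw [if_neg hwD] at this
    linarith
  simp only [if_pos hwD] at hle
  have hconst := Complex.norm_eqOn_of_isPreconnected_of_isMaxOn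
    (convex_ball (0 : ℂ) 1).isPreconnected isOpen_disk hg hwD hle
  have := nhdsWithin_disk_neBot (ζ := 1) norm_one
  have hlim : Tendsto (fun z => ‖g z‖) (𝓝[Disk] 1) (𝓝 ‖g w‖) := by
    refine tendsto_const_nhds.congr' ?_
    filter_upwards [self_mem_nhdsWithin] with u hu using (hconst hu).symm
  have := tendsto_nhds_unique hlim (h 1 norm_one)
  linarith [hle z hz]

lemma TendstoUnimodular.exists_const {g : ℂ → ℂ} (hg : DifferentiableOn ℂ g Disk)
    (h : TendstoUnimodular g) (h0 : ∀ z ∈ Disk, g z ≠ 0) :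
    ∃ c : ℂ, ‖c‖ = 1 ∧ ∀ z ∈ Disk, g z = c := by
  have hinv : TendstoUnimodular fun z => (g z)⁻¹ := fun ζ hζ => by
    simpa using (h ζ hζ).inv₀ one_ne_zero
  have hone : ∀ z ∈ Disk, ‖g z‖ = 1 := by
    intro z hz
    refine le_antisymm (h.norm_le_one hg hz) ?_
    have := hinv.norm_le_one (hg.inv h0) hz
    rwa [Pi.inv_apply, norm_inv, inv_le_one₀ (norm_pos_iff.2 (h0 z hz))] at this
  have h0D : (0 : ℂ) ∈ Disk := by simp [mem_disk]
  refine ⟨g 0, hone 0 h0D, ?_⟩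
  exact Complex.eqOn_of_isPreconnected_of_isMaxOn_norm
    (convex_ball (0 : ℂ) 1).isPreconnected isOpen_disk hg h0D
    fun z hz => by simp [hone z hz, hone 0 h0D]

lemma norm_sub_eq_of_norm_one {a ζ : ℂ} (hζ : ‖ζ‖ = 1) :
    ‖ζ - a‖ = ‖1 - (starRingEnd ℂ) a * ζ‖ := by
  have h : ζ - a = ζ * (starRingEnd ℂ) (1 - (starRingEnd ℂ) a * ζ) := by
    have : ζ * (starRingEnd ℂ) ζ = 1 := by
      rw [Complex.mul_conj, Complex.normSq_eq_norm_sq, hζ]; simp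
    simp only [map_sub, map_one, map_mul, Complex.conj_conj]
    linear_combination a * this
  rw [h, norm_mul, hζ, one_mul, RCLike.norm_conj]

lemma norm_sub_lt_norm_one_sub_conj_mul {a z : ℂ} (ha : ‖a‖ < 1) (hz : ‖z‖ < 1) :
    ‖z - a‖ < ‖1 - (starRingEnd ℂ) a * z‖ := by
  refine lt_of_pow_lt_pow_left₀ 2 (norm_nonneg _) ?_
  have h : ‖1 - (starRingEnd ℂ) a * z‖ ^ 2 - ‖z - a‖ ^ 2 = (1 - ‖a‖ ^ 2) * (1 - ‖z‖ ^ 2) := by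
    simp only [← Complex.normSq_eq_norm_sq, Complex.normSq_apply]
    simp
    ring
  have h1 : 0 < 1 - ‖a‖ ^ 2 := by nlinarith [norm_nonneg a]
  have h2 : 0 < 1 - ‖z‖ ^ 2 := by nlinarith [norm_nonneg z]
  nlinarith [mul_pos h1 h2]

/-- A zero of a function with unimodular boundary values can be divided out. -/
lemma TendstoUnimodular.exists_factor {g : ℂ → ℂ} (hg : DifferentiableOn ℂ g Disk)
    (h : TendstoUnimodular g) {a : ℂ} (ha : a ∈ Disk) (hga : g a = 0) :
    ∃ h : ℂ → ℂ, DifferentiableOn ℂ h Disk ∧ TendstoUnimodular h ∧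
      ∀ z ∈ Disk, g z = (z - a) / (1 - (starRingEnd ℂ) a * z) * h z := by
  have ha1 := mem_disk.1 ha
  have hfac : ∀ z ∈ Disk, g z = (z - a) / (1 - (starRingEnd ℂ) a * z) *
      (dslope g a z * (1 - (starRingEnd ℂ) a * z)) := by
    intro z hz
    have hne := one_sub_conj_mul_ne_zero ha1 (mem_disk.1 hz).le
    have := sub_smul_dslope g a z
    rw [hga, sub_zero, smul_eq_mul] at this
    rw [← this, mul_comm (dslope g a z) (1 - _), ← mul_assoc, div_mul_cancel₀ _ hne]
  refine ⟨fun z => dslope g a z * (1 - (starRingEnd ℂ) a * z), ?_, ?_, hfac⟩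
  · exact ((Complex.differentiableOn_dslope (isOpen_disk.mem_nhds ha)).2 hg).mul (by fun_prop)
  · intro ζ hζ
    have hpos := norm_one_sub_conj_mul_pos ha1 hζ.le
    set B : ℂ → ℂ := fun z => (z - a) / (1 - (starRingEnd ℂ) a * z) with hB
    have hb : Tendsto (fun z => ‖B z‖) (𝓝[Disk] ζ) (𝓝 1) := by
      have hc : ContinuousAt B ζ :=
        ContinuousAt.div (by fun_prop) (by fun_prop) (norm_pos_iff.1 hpos)
      have h1 : ‖B ζ‖ = 1 := by
        rw [hB, norm_div, norm_sub_eq_of_norm_one hζ, div_self hpos.ne']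
      rw [← h1]
      exact hc.norm.tendsto.mono_left nhdsWithin_le_nhds
    have hq : Tendsto (fun z => ‖g z‖ / ‖B z‖) (𝓝[Disk] ζ) (𝓝 (1 / 1)) :=
      (h ζ hζ).div hb one_ne_zero
    rw [div_one] at hq
    refine hq.congr' ?_
    filter_upwards [self_mem_nhdsWithin, hb.eventually_ne one_ne_zero] with z hz hz'
    rw [hfac z hz, norm_mul, mul_div_cancel_left₀ _ hz']

lemma TendstoUnimodular.exists_ne_zero {g : ℂ → ℂ} (h : TendstoUnimodular g) :
    ∃ z ∈ Disk, g z ≠ 0 := by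
  have := nhdsWithin_disk_neBot (ζ := 1) norm_one
  obtain ⟨z, hz, hz'⟩ := (((h 1 norm_one).eventually_ne one_ne_zero).and
    self_mem_nhdsWithin).exists
  exact ⟨z, hz', norm_ne_zero_iff.1 hz⟩

lemma TendstoUnimodular.isCompact_zeros {g : ℂ → ℂ} (hg : ContinuousOn g Disk)
    (h : TendstoUnimodular g) : IsCompact {z ∈ Disk | g z = 0} := by
  classical
  have := (h.continuousOn hg).preimage_isClosed_of_isClosed Metric.isClosed_closedBall
    (isClosed_singleton (x := (0 : ℝ)))
  convert (isCompact_closedBall (0 : ℂ) 1).of_isClosed_subset this Set.inter_subset_left using 1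
  ext z
  by_cases hz : z ∈ Disk
  · have : z ∈ Metric.closedBall (0 : ℂ) 1 := Metric.ball_subset_closedBall hz
    simp only [Set.mem_ofPred_eq, Set.mem_inter_iff, this, Set.mem_preimage, hz, if_true, true_and,
      Set.mem_singleton_iff, norm_eq_zero]
  · simp [hz]

/-- A holomorphic function on the disk whose modulus tends to `1` at the unit circle is a finite
Blaschke product. -/
lemma TendstoUnimodular.finiteBlaschke {g : ℂ → ℂ} (hg : DifferentiableOn ℂ g Disk)
    (h : TendstoUnimodular g) : FiniteBlaschke g := by
  let P : ℕ → Prop := fun n => ∃ (a : Fin n → ℂ) (k : ℂ → ℂ), (∀ i, ‖a i‖ < 1) ∧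
    DifferentiableOn ℂ k Disk ∧ TendstoUnimodular k ∧
    ∀ z ∈ Disk, g z = (∏ i, (z - a i) / (1 - (starRingEnd ℂ) (a i) * z)) * k z
  have hP0 : P 0 := ⟨Fin.elim0, g, fun i => i.elim0, hg, h, fun z _ => by simp⟩
  have hbound : ∃ N, ¬ P N := by
    obtain ⟨z₀, hz₀, hgz₀⟩ := h.exists_ne_zero
    rw [mem_disk] at hz₀
    obtain ⟨κ, hκ1, hκ⟩ : ∃ κ : ℝ, κ < 1 ∧ ∀ a ∈ {z ∈ Disk | g z = 0},
        ‖(z₀ - a) / (1 - (starRingEnd ℂ) a * z₀)‖ ≤ κ := by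
      rcases Set.eq_empty_or_nonempty {z ∈ Disk | g z = 0} with he | hne
      · exact ⟨0, one_pos, by simp [he]⟩
      · obtain ⟨b, hb, hmax⟩ := (h.isCompact_zeros hg.continuousOn).exists_isMaxOn hne
          (f := fun a => ‖(z₀ - a) / (1 - (starRingEnd ℂ) a * z₀)‖) (by
            refine (ContinuousOn.div (by fun_prop) ?_ fun a ha =>
              one_sub_conj_mul_ne_zero (mem_disk.1 ha.1) hz₀.le).norm
            exact (continuous_const.sub (Complex.continuous_conj.mul continuous_const)).continuousOn)
        refine ⟨_, ?_, fun a ha => hmax ha⟩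
        have hb1 := mem_disk.1 hb.1
        simp only [norm_div]
        rw [div_lt_one (norm_one_sub_conj_mul_pos hb1 hz₀.le)]
        exact norm_sub_lt_norm_one_sub_conj_mul hb1 hz₀
    by_contra! hall
    have hpow : ∀ n, ‖g z₀‖ ≤ κ ^ n := by
      intro n
      obtain ⟨a, k, ha, hk, hku, hfac⟩ := hall n
      rw [hfac z₀ (mem_disk.2 hz₀), norm_mul, norm_prod]
      calc _ ≤ (∏ i, ‖(z₀ - a i) / (1 - (starRingEnd ℂ) (a i) * z₀)‖) * 1 := by
            gcongr
            exact hku.norm_le_one hk (mem_disk.2 hz₀)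
        _ ≤ ∏ _i : Fin n, κ := by
            rw [mul_one]
            refine Finset.prod_le_prod (fun _ _ => norm_nonneg _) fun i _ => hκ _ ?_
            refine ⟨mem_disk.2 (ha i), ?_⟩
            rw [hfac _ (mem_disk.2 (ha i)), Finset.prod_eq_zero (Finset.mem_univ i) (by simp),
              zero_mul]
        _ = κ ^ n := by simp
    have hκ0 : 0 ≤ κ := (norm_nonneg _).trans (by simpa using hpow 1)
    obtain ⟨n, hn⟩ := exists_pow_lt_of_lt_one (norm_pos_iff.2 hgz₀) hκ1
    linarith [hpow n]
  obtain ⟨n, hn, hn'⟩ : ∃ n, P n ∧ ¬ P (n + 1) := by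
    by_contra! hstep
    obtain ⟨N, hN⟩ := hbound
    exact hN (Nat.rec hP0 hstep N)
  obtain ⟨a, k, ha, hk, hku, hfac⟩ := hn
  obtain ⟨c, hc, hkc⟩ := hku.exists_const hk fun b hb hkb => hn' (by
    obtain ⟨l, hl, hlu, hlfac⟩ := hku.exists_factor hk hb hkb
    refine ⟨Fin.cons b a, l, Fin.cases (mem_disk.1 hb) ha, hl, hlu, fun z hz => ?_⟩
    rw [hfac z hz, hlfac z hz, Fin.prod_univ_succ]
    simp only [Fin.cons_zero, Fin.cons_succ]
    ring)
  exact ⟨c, hc, n, a, ha, fun z hz => by rw [hfac z hz, hkc z hz, mul_comm]⟩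

lemma ae_exp_mul_I_ne (ζ : ℂ) : ∀ᵐ t : ℝ, Complex.exp (t * Complex.I) ≠ ζ := by
  have hc : {t : ℝ | Complex.exp (t * Complex.I) = ζ}.Countable := by
    rcases Set.eq_empty_or_nonempty {t : ℝ | Complex.exp (t * Complex.I) = ζ} with he | ⟨s, hs⟩
    · rw [he]; exact Set.countable_empty
    · refine (Set.countable_range fun n : ℤ => s + n * (2 * Real.pi)).mono fun t ht => ?_
      have hts : Complex.exp (t * Complex.I) = Complex.exp (s * Complex.I) := Eq.trans ht hs.symm
      obtain ⟨n, hn⟩ := Complex.exp_eq_exp_iff_exists_int.1 hts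
      refine ⟨n, ?_⟩
      have : (t : ℂ) = ((s + n * (2 * Real.pi) : ℝ) : ℂ) := by
        refine mul_right_cancel₀ Complex.I_ne_zero ?_
        rw [hn]; push_cast; ring
      exact (Complex.ofReal_injective this).symm
  simpa [ae_iff] using hc.measure_zero volume

lemma norm_one_sub_conj_mul_le_two_mul {w e : ℂ} (hw : ‖w‖ ≤ 1) (he : ‖e‖ ≤ 1) {r : ℝ}
    (hr : 0 ≤ r) (hr1 : r ≤ 1) :
    ‖1 - (starRingEnd ℂ) w * e‖ ≤ 2 * ‖1 - (starRingEnd ℂ) w * (r * e)‖ := by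
  set u := (starRingEnd ℂ) w * e with hu
  have hu1 : ‖u‖ ≤ 1 := by
    rw [hu, norm_mul, RCLike.norm_conj]
    exact mul_le_one₀ hw (norm_nonneg _) he
  have h1 : (starRingEnd ℂ) w * (r * e) = r * u := by rw [hu]; ring
  have hru : ‖(r : ℂ) * u‖ ≤ r := by
    rw [norm_mul, Complex.norm_real, Real.norm_of_nonneg hr]
    exact mul_le_of_le_one_right hr hu1
  have h2 : ‖((1 - r : ℝ) : ℂ) * u‖ ≤ 1 - r := by
    rw [norm_mul, Complex.norm_real, Real.norm_of_nonneg (sub_nonneg.2 hr1)]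
    exact mul_le_of_le_one_right (sub_nonneg.2 hr1) hu1
  have h3 := norm_sub_norm_le (1 : ℂ) (r * u)
  rw [norm_one] at h3
  have h4 : 1 - u = (1 - r * u) - ((1 - r : ℝ) : ℂ) * u := by push_cast; ring
  rw [h1, h4]
  linarith [norm_sub_le (1 - r * u) (((1 - r : ℝ) : ℂ) * u)]

lemma one_sub_norm_right_le {w z : ℂ} (hw : ‖w‖ ≤ 1) :
    1 - ‖z‖ ≤ ‖1 - (starRingEnd ℂ) w * z‖ := by
  have h : 1 - (starRingEnd ℂ) w * z = (starRingEnd ℂ) (1 - (starRingEnd ℂ) z * w) := by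
    simp [mul_comm]
  rw [h, RCLike.norm_conj]
  exact one_sub_norm_le_norm_one_sub_conj_mul hw

/-- Summation of a dominated series of functions in `H_p`. -/
lemma hasHpBoundary_tsum {p : ℝ} (hp : 0 < p) {h : ℕ → ℂ → ℂ} {hb : ℕ → ℝ → ℂ} {Y : ℕ → ℝ → ℝ}
    {u : ℕ → ℝ} {C : ℝ} (hC : 0 < C) (hd : ∀ j, DifferentiableOn ℂ (h j) Disk)
    (hu : Summable u) (hu0 : ∀ j, 0 ≤ u j)
    (hloc : ∀ j, ∀ z ∈ Disk, ‖h j z‖ ≤ u j / (1 - ‖z‖))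
    (hY0 : ∀ j t, 0 ≤ Y j t) (hYm : ∀ j, Measurable (Y j))
    (hdom : ∀ j (t : ℝ), ∀ r : ℝ, 0 ≤ r → r < 1 →
      ‖h j ((r : ℂ) * Complex.exp (t * Complex.I))‖ ≤ C * (1 / 2) ^ j * Y j t)
    (hYint : ∀ j, ∫⁻ t in Set.Ioc (0 : ℝ) (2 * Real.pi), ENNReal.ofReal (Y j t ^ p) ≤
      ENNReal.ofReal ((1 / 2) ^ j))
    (hYsum : ∀ᵐ t : ℝ, Summable fun j => (1 / 2) ^ j * Y j t)
    (hlim : ∀ j, ∀ᵐ t : ℝ, radLim (h j) t (hb j t)) :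
    HasHpBoundary p (fun z => ∑' j, h j z) (fun t => ∑' j, hb j t) := by
  have hdiff : DifferentiableOn ℂ (fun z => ∑' j, h j z) Disk := by
    intro z hz
    obtain ⟨ρ, hzρ, hρ⟩ := exists_between (mem_disk.1 hz)
    have hsub : Metric.ball (0 : ℂ) ρ ⊆ Disk := Metric.ball_subset_ball hρ.le
    have := Complex.differentiableOn_tsum_of_summable_norm (hu.div_const (1 - ρ))
      (fun j => (hd j).mono hsub) Metric.isOpen_ball fun j w hw => by
        have hw' : ‖w‖ < ρ := by simpa using hw
        refine (hloc j w (hsub hw)).trans ?_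
        have := hu0 j
        gcongr
    exact (this.differentiableAt
      (Metric.isOpen_ball.mem_nhds (by simpa using hzρ))).differentiableWithinAt
  refine ⟨hdiff, ⟨(2 * C) ^ p * 2, fun r hr hr1 => ?_⟩, ?_⟩
  · have hcont := continuous_comp_circle hdiff.continuousOn hr hr1
    have hpt : ∀ t : ℝ, ENNReal.ofReal
        (‖∑' j, h j ((r : ℂ) * Complex.exp (t * Complex.I))‖ ^ p) ≤
        ENNReal.ofReal ((2 * C) ^ p) * ∑' j, ENNReal.ofReal (Y j t ^ p) := by
      intro t
      by_cases hS : ∑' j, ENNReal.ofReal (Y j t ^ p) = ⊤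
      · rw [hS, ENNReal.mul_top (by simpa using by positivity)]
        exact le_top
      · set s := (∑' j, ENNReal.ofReal (Y j t ^ p)).toReal with hs
        have hs0 : 0 ≤ s := ENNReal.toReal_nonneg
        have hY : ∀ j, Y j t ≤ s ^ p⁻¹ := by
          intro j
          rw [Real.le_rpow_inv_iff_of_pos (hY0 j t) hs0 hp, hs, ← ENNReal.ofReal_le_iff_le_toReal hS]
          exact ENNReal.le_tsum j
        have hgeo : HasSum (fun j : ℕ => C * s ^ p⁻¹ * (1 / 2 : ℝ) ^ j) (C * s ^ p⁻¹ * 2) :=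
          hasSum_geometric_two.mul_left _
        have hH := tsum_of_norm_bounded hgeo fun j => (hdom j t r hr hr1).trans (by
          have := hY j
          calc C * (1 / 2) ^ j * Y j t ≤ C * (1 / 2) ^ j * s ^ p⁻¹ := by gcongr
            _ = C * s ^ p⁻¹ * (1 / 2) ^ j := by ring)
        rw [← ENNReal.ofReal_toReal hS, ← hs, ← ENNReal.ofReal_mul (by positivity)]
        refine ENNReal.ofReal_le_ofReal ?_
        calc _ ≤ (C * s ^ p⁻¹ * 2) ^ p := by gcongr
          _ = (2 * C) ^ p * s := by
            rw [show C * s ^ p⁻¹ * 2 = 2 * C * s ^ p⁻¹ by ring,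
              Real.mul_rpow (by positivity) (by positivity), Real.rpow_inv_rpow hs0 hp.ne']
    rw [integral_eq_lintegral_of_nonneg_ae (ae_of_all _ fun t => by positivity)
      (hcont.norm.rpow_const fun _ => Or.inr hp.le).aestronglyMeasurable]
    refine ENNReal.toReal_le_of_le_ofReal (by positivity) ?_
    calc _ ≤ ∫⁻ t in Set.Ioc (0 : ℝ) (2 * Real.pi),
          ENNReal.ofReal ((2 * C) ^ p) * ∑' j, ENNReal.ofReal (Y j t ^ p) :=
          lintegral_mono hpt
      _ = ENNReal.ofReal ((2 * C) ^ p) * ∑' j, ∫⁻ t in Set.Ioc (0 : ℝ) (2 * Real.pi),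
          ENNReal.ofReal (Y j t ^ p) := by
          rw [lintegral_const_mul' _ _ ENNReal.ofReal_ne_top, lintegral_tsum]
          exact fun j => ((hYm j).pow_const p).ennreal_ofReal.aemeasurable
      _ ≤ ENNReal.ofReal ((2 * C) ^ p) * ∑' j : ℕ, ENNReal.ofReal ((1 / 2) ^ j) := by
          gcongr with j
          exact hYint j
      _ = ENNReal.ofReal ((2 * C) ^ p * 2) := by
          rw [← ENNReal.ofReal_tsum_of_nonneg (fun _ => by positivity) summable_geometric_two,
            tsum_geometric_two, ENNReal.ofReal_mul (by positivity)]
  · filter_upwards [hYsum, ae_all_iff.2 hlim] with t h1 h2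
    refine tendsto_tsum_of_dominated_convergence (h1.mul_left C) (fun j => h2 j) ?_
    filter_upwards [eventually_mem_Ioo] with r hr j
    rw [← mul_assoc]
    exact hdom j t r hr.1.le hr.2

lemma measurable_kernel (c : ℝ) (w : ℂ) : Measurable fun t : ℝ =>
    c * ((1 - ‖w‖) / ‖1 - (starRingEnd ℂ) w * Complex.exp (t * Complex.I)‖) := by
  have h : Continuous fun t : ℝ => ‖1 - (starRingEnd ℂ) w * Complex.exp (t * Complex.I)‖ := by
    fun_prop
  exact (measurable_const.div h.measurable).const_mul c

/-- The normalised Cauchy kernels tend to zero in `L^p` at the boundary. -/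
lemma tendsto_lintegral_kernel {p : ℝ} (hp : 0 < p) {ζ : ℂ} (hζ : ‖ζ‖ = 1) {c : ℝ} (hc : 0 ≤ c) :
    Tendsto (fun w : ℂ => ∫⁻ t in Set.Ioc (0 : ℝ) (2 * Real.pi), ENNReal.ofReal
      ((c * ((1 - ‖w‖) / ‖1 - (starRingEnd ℂ) w * Complex.exp (t * Complex.I)‖)) ^ p))
      (𝓝[Disk] ζ) (𝓝 0) := by
  have := tendsto_lintegral_filter_of_dominated_convergence (l := 𝓝[Disk] ζ)
    (μ := volume.restrict (Set.Ioc (0 : ℝ) (2 * Real.pi))) (f := fun _ => 0)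
    (F := fun w t => ENNReal.ofReal
      ((c * ((1 - ‖w‖) / ‖1 - (starRingEnd ℂ) w * Complex.exp (t * Complex.I)‖)) ^ p))
    (fun _ => ENNReal.ofReal (c ^ p)) (Eventually.of_forall fun w =>
      ((measurable_kernel c w).pow_const p).ennreal_ofReal) ?_ ?_ ?_
  · simpa using this
  · filter_upwards [self_mem_nhdsWithin] with w hw
    rw [mem_disk] at hw
    refine ae_of_all _ fun t => ENNReal.ofReal_le_ofReal ?_
    have he : ‖Complex.exp (t * Complex.I)‖ ≤ 1 := (Complex.norm_exp_ofReal_mul_I t).le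
    have hpos := norm_one_sub_conj_mul_pos hw he
    have h1 : (1 - ‖w‖) / ‖1 - (starRingEnd ℂ) w * Complex.exp (t * Complex.I)‖ ≤ 1 :=
      (div_le_one hpos).2 (one_sub_norm_le_norm_one_sub_conj_mul he)
    have h0 : 0 ≤ (1 - ‖w‖) / ‖1 - (starRingEnd ℂ) w * Complex.exp (t * Complex.I)‖ :=
      div_nonneg (sub_nonneg.2 hw.le) hpos.le
    refine Real.rpow_le_rpow (mul_nonneg hc h0) ?_ hp.le
    exact mul_le_of_le_one_right hc h1
  · rw [lintegral_const]
    exact ENNReal.mul_ne_top ENNReal.ofReal_ne_top (measure_ne_top _ _)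
  · refine ae_restrict_of_ae ?_
    filter_upwards [ae_exp_mul_I_ne ζ] with t ht
    have hen : ‖Complex.exp (t * Complex.I)‖ = 1 := Complex.norm_exp_ofReal_mul_I t
    have hne : ‖1 - (starRingEnd ℂ) ζ * Complex.exp (t * Complex.I)‖ ≠ 0 := by
      rw [← norm_sub_eq_of_norm_one hen, norm_ne_zero_iff]
      exact sub_ne_zero.2 ht
    have hcont : ContinuousAt (fun w : ℂ => ENNReal.ofReal
        ((c * ((1 - ‖w‖) / ‖1 - (starRingEnd ℂ) w * Complex.exp (t * Complex.I)‖)) ^ p)) ζ := by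
      refine ENNReal.continuous_ofReal.continuousAt.comp ?_
      refine ContinuousAt.rpow_const ?_ (Or.inr hp.le)
      refine continuousAt_const.mul (ContinuousAt.div (by fun_prop) ?_ hne)
      exact (continuous_const.sub
        (Complex.continuous_conj.mul continuous_const)).norm.continuousAt
    have h0 := hcont.tendsto.mono_left (nhdsWithin_le_nhds (s := Disk))
    simpa [hζ, Real.zero_rpow hp.ne'] using h0

lemma norm_sub_le_of_schwarz {θ : ℂ → ℂ} (hθ : DifferentiableOn ℂ θ Disk)
    (hθ1 : ∀ z ∈ Disk, ‖θ z‖ ≤ 1) {w z : ℂ} (hw : w ∈ Disk) (hz : z ∈ Disk) :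
    ‖θ z - θ w‖ ≤ 2 * (‖z - w‖ / ‖1 - (starRingEnd ℂ) w * z‖) := by
  have hw1 := mem_disk.1 hw
  set φ : ℂ → ℂ := fun u => (w - u) / (1 - (starRingEnd ℂ) w * u) with hφ
  have hne : ∀ u ∈ Disk, 1 - (starRingEnd ℂ) w * u ≠ 0 := fun u hu =>
    one_sub_conj_mul_ne_zero hw1 (mem_disk.1 hu).le
  have hφD : Set.MapsTo φ Disk Disk := by
    intro u hu
    have hu1 := mem_disk.1 hu
    rw [mem_disk, hφ, norm_div, div_lt_one (norm_one_sub_conj_mul_pos hw1 hu1.le), norm_sub_rev]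
    exact norm_sub_lt_norm_one_sub_conj_mul hw1 hu1
  have hφd : DifferentiableOn ℂ φ Disk :=
    DifferentiableOn.div (by fun_prop) (by fun_prop) hne
  have hφ0 : φ 0 = w := by simp [hφ]
  have hφφ : φ (φ z) = z := by
    have h1 := hne z hz
    have h2 := hne w hw
    have h3 := hne _ (hφD hz)
    have hm : φ z * (1 - (starRingEnd ℂ) w * z) = w - z := div_mul_cancel₀ _ h1
    change (w - φ z) / (1 - (starRingEnd ℂ) w * φ z) = z
    rw [div_eq_iff h3]
    linear_combination -hm
  have h := Complex.dist_le_div_mul_dist_of_mapsTo_ball (f := θ ∘ φ) (c := 0) (R₁ := 1) (R₂ := 2)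
    (hθ.comp hφd hφD) (fun u hu => by
      rw [mem_closedBall_iff_norm]
      refine (norm_sub_le _ _).trans ?_
      have h1 := hθ1 _ (hφD hu)
      have h2 := hθ1 _ (hφD (show (0 : ℂ) ∈ Disk by simp [mem_disk]))
      simp only [Function.comp_apply]
      linarith) (hφD hz)
  simp only [Function.comp_apply, hφφ, hφ0, dist_eq_norm, sub_zero, div_one] at h
  refine h.trans_eq ?_
  rw [hφ, norm_div, norm_sub_rev]

lemma norm_dslope_le_of_schwarz {θ : ℂ → ℂ} (hθ : DifferentiableOn ℂ θ Disk)
    (hθ1 : ∀ z ∈ Disk, ‖θ z‖ ≤ 1) {w z : ℂ} (hw : w ∈ Disk) (hz : z ∈ Disk) :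
    ‖dslope θ w z‖ ≤ 2 / ‖1 - (starRingEnd ℂ) w * z‖ := by
  have hw1 := mem_disk.1 hw
  have hoff : ∀ u ∈ Disk, u ≠ w → ‖dslope θ w u‖ * ‖1 - (starRingEnd ℂ) w * u‖ ≤ 2 := by
    intro u hu huw
    have hpos := norm_one_sub_conj_mul_pos hw1 (mem_disk.1 hu).le
    have hpos' : 0 < ‖u - w‖ := norm_pos_iff.2 (sub_ne_zero.2 huw)
    have h := norm_sub_le_of_schwarz hθ hθ1 hw hu
    rw [← sub_smul_dslope θ w u, smul_eq_mul, norm_mul, ← mul_div_assoc, le_div_iff₀ hpos] at h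
    nlinarith
  rw [le_div_iff₀ (norm_one_sub_conj_mul_pos hw1 (mem_disk.1 hz).le)]
  by_cases hzw : z = w
  · subst hzw
    have hcont : ContinuousAt (fun u => ‖dslope θ z u‖ * ‖1 - (starRingEnd ℂ) z * u‖) z := by
      have : ContinuousAt (dslope θ z) z :=
        continuousAt_dslope_same.2 ((hθ z hz).differentiableAt (isOpen_disk.mem_nhds hz))
      exact this.norm.mul (by fun_prop)
    refine le_of_tendsto (hcont.tendsto.mono_left (nhdsWithin_le_nhds (s := {z}ᶜ))) ?_
    filter_upwards [self_mem_nhdsWithin, mem_nhdsWithin_of_mem_nhds (isOpen_disk.mem_nhds hz)]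
      with u hu1 hu2 using hoff u hu2 hu1
  · exact hoff z hz hzw

/-- Combinations, with bounded coefficients, of kernels concentrating at `ζ` lie in `H_p`. -/
lemma hasHpBoundary_tsum_kernel {p : ℝ} (hp : 0 < p) {ζ : ℂ} (hζ : ‖ζ‖ = 1) {w : ℕ → ℂ}
    (hw : ∀ j, w j ∈ Disk) (hwζ : ∀ j, ‖w j - ζ‖ ≤ (1 / 8) ^ j)
    (hint : ∀ j, ∫⁻ t in Set.Ioc (0 : ℝ) (2 * Real.pi), ENNReal.ofReal
      ((4 ^ j * ((1 - ‖w j‖) / ‖1 - (starRingEnd ℂ) (w j) * Complex.exp (t * Complex.I)‖)) ^ p) ≤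
      ENNReal.ofReal ((1 / 2) ^ j))
    {k : ℕ → ℂ → ℂ} {kb : ℕ → ℝ → ℂ} (hk : ∀ j, DifferentiableOn ℂ (k j) Disk)
    (hk2 : ∀ j, ∀ z ∈ Disk, ‖k j z‖ ≤ 2 / ‖1 - (starRingEnd ℂ) (w j) * z‖)
    (hlim : ∀ j, ∀ᵐ t : ℝ, radLim (k j) t (kb j t)) {b : ℕ → ℂ} {M : ℝ} (hM : 0 < M)
    (hb : ∀ j, ‖b j‖ ≤ M) :
    HasHpBoundary p (fun z => ∑' j, b j * (((2 ^ j * (1 - ‖w j‖) : ℝ) : ℂ) * k j z))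
      (fun t => ∑' j, b j * (((2 ^ j * (1 - ‖w j‖) : ℝ) : ℂ) * kb j t)) := by
  have hd0 : ∀ j, 0 < 1 - ‖w j‖ := fun j => sub_pos.2 (mem_disk.1 (hw j))
  have hd8 : ∀ j, 1 - ‖w j‖ ≤ (1 / 8) ^ j := fun j => by
    have := norm_sub_norm_le ζ (w j)
    rw [hζ, norm_sub_rev] at this
    exact this.trans (hwζ j)
  have hnorm : ∀ j, ∀ z ∈ Disk, ‖b j * (((2 ^ j * (1 - ‖w j‖) : ℝ) : ℂ) * k j z)‖ ≤
      M * (2 ^ j * (1 - ‖w j‖)) * (2 / ‖1 - (starRingEnd ℂ) (w j) * z‖) := by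
    intro j z hz
    have h0 : 0 ≤ 2 ^ j * (1 - ‖w j‖) := mul_nonneg (by positivity) (hd0 j).le
    rw [norm_mul, norm_mul, Complex.norm_real, Real.norm_of_nonneg h0, ← mul_assoc]
    exact mul_le_mul (mul_le_mul_of_nonneg_right (hb j) h0) (hk2 j z hz) (norm_nonneg _)
      (mul_nonneg hM.le h0)
  refine hasHpBoundary_tsum hp
    (Y := fun j t => 4 ^ j *
      ((1 - ‖w j‖) / ‖1 - (starRingEnd ℂ) (w j) * Complex.exp (t * Complex.I)‖))
    (u := fun j => 2 * M * (1 / 4) ^ j) (C := 4 * M) (by positivity)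
    (fun j => (differentiableOn_const _).mul ((differentiableOn_const _).mul (hk j)))
    ((summable_geometric_of_lt_one (by norm_num) (by norm_num)).mul_left _)
    (fun j => by positivity) (fun j z hz => ?_)
    (fun j t => mul_nonneg (by positivity) (div_nonneg (hd0 j).le (norm_nonneg _)))
    (fun j => measurable_kernel _ _) (fun j t r hr hr1 => ?_) hint ?_ fun j => ?_
  · have hz1 := sub_pos.2 (mem_disk.1 hz)
    calc _ ≤ M * (2 ^ j * (1 - ‖w j‖)) * (2 / ‖1 - (starRingEnd ℂ) (w j) * z‖) := hnorm j z hz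
      _ ≤ M * (2 ^ j * (1 / 8) ^ j) * (2 / (1 - ‖z‖)) := by
        have h1 := hd8 j
        have h2 := one_sub_norm_right_le (z := z) (mem_disk.1 (hw j)).le
        have h3 := hd0 j
        gcongr
      _ = 2 * M * (1 / 4) ^ j / (1 - ‖z‖) := by
        rw [← mul_pow]; norm_num; ring
  · have hpos := norm_one_sub_conj_mul_pos (mem_disk.1 (hw j))
      (Complex.norm_exp_ofReal_mul_I t).le
    have h1 := norm_one_sub_conj_mul_le_two_mul (mem_disk.1 (hw j)).le
      (Complex.norm_exp_ofReal_mul_I t).le hr hr1.le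
    refine (hnorm j _ (ofReal_mul_exp_mem_disk hr hr1 t)).trans ?_
    set A := ‖1 - (starRingEnd ℂ) (w j) * Complex.exp (t * Complex.I)‖
    set B := ‖1 - (starRingEnd ℂ) (w j) * (r * Complex.exp (t * Complex.I))‖
    have hB : 2 / B ≤ 4 / A := by
      rw [div_le_div_iff₀ (by linarith) hpos]; linarith
    have h3 := hd0 j
    calc _ ≤ M * (2 ^ j * (1 - ‖w j‖)) * (4 / A) := by gcongr
      _ = 4 * M * (1 / 2) ^ j * (4 ^ j * ((1 - ‖w j‖) / A)) := by
        rw [show (4 : ℝ) = 2 * 2 by norm_num, mul_pow, one_div, inv_pow]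
        field_simp
  · filter_upwards [ae_exp_mul_I_ne ζ] with t ht
    set e := Complex.exp (t * Complex.I) with he
    have hen : ‖e‖ = 1 := Complex.norm_exp_ofReal_mul_I t
    have hc : 0 < ‖e - ζ‖ := norm_pos_iff.2 (sub_ne_zero.2 ht)
    have hev : ∀ᶠ j in atTop, (1 / 8 : ℝ) ^ j < ‖e - ζ‖ / 2 :=
      (tendsto_pow_atTop_nhds_zero_of_lt_one (by norm_num) (by norm_num)).eventually_lt_const
        (by linarith)
    refine Summable.of_norm_bounded_eventually_nat (g := fun j => 2 / ‖e - ζ‖ * (1 / 4) ^ j)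
      ((summable_geometric_of_lt_one (by norm_num) (by norm_num)).mul_left _) ?_
    filter_upwards [hev] with j hj
    have hA : ‖e - ζ‖ / 2 ≤ ‖1 - (starRingEnd ℂ) (w j) * e‖ := by
      rw [← norm_sub_eq_of_norm_one hen]
      have h1 := norm_sub_le_norm_sub_add_norm_sub e (w j) ζ
      linarith [hwζ j]
    have h3 := hd0 j
    have h4 := hd8 j
    rw [Real.norm_of_nonneg (mul_nonneg (by positivity)
      (mul_nonneg (by positivity) (div_nonneg h3.le (norm_nonneg _))))]
    calc (1 / 2 : ℝ) ^ j * (4 ^ j * ((1 - ‖w j‖) / ‖1 - (starRingEnd ℂ) (w j) * e‖))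
        ≤ (1 / 2) ^ j * (4 ^ j * ((1 / 8) ^ j / (‖e - ζ‖ / 2))) := by gcongr
      _ = (1 / 2 * 4 * (1 / 8)) ^ j * (2 / ‖e - ζ‖) := by
        rw [mul_pow, mul_pow]; field_simp
      _ = 2 / ‖e - ζ‖ * (1 / 4) ^ j := by norm_num; ring
  · filter_upwards [hlim j] with t ht
    exact radLim_mul (radLim_const _ _) (radLim_mul (radLim_const _ _) ht)

lemma radLim_dslope {θ : ℂ → ℂ} {t : ℝ} {c w : ℂ} (h : radLim θ t c) (hw : w ∈ Disk) :
    radLim (dslope θ w) t ((c - θ w) / (Complex.exp (t * Complex.I) - w)) := by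
  have hw1 := mem_disk.1 hw
  have hne : Complex.exp (t * Complex.I) - w ≠ 0 := by
    refine sub_ne_zero.2 fun he => ?_
    rw [← he, Complex.norm_exp_ofReal_mul_I] at hw1
    exact lt_irrefl _ hw1
  have hlim := radLim_of_continuousAt (F := fun z => z - w) (G := fun z => z - w) (t := t)
    (fun _ _ => rfl) (by fun_prop)
  refine ((h.sub_const (θ w)).div hlim hne).congr' ?_
  filter_upwards [Ioo_mem_nhdsLT hw1] with r hr
  have hr0 : 0 ≤ r := (norm_nonneg _).trans hr.1.le
  have hrw : (r : ℂ) * Complex.exp (t * Complex.I) ≠ w := fun he => by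
    have := norm_ofReal_mul_exp hr0 t
    rw [he] at this
    exact hr.1.ne this
  rw [dslope_of_ne _ hrw, slope_def_field]
  rfl

/-- Coordinates are uniformly bounded for a pointwise bounded family of functionals on `ℓ^∞`. -/
lemma exists_norm_le_of_tsum_bounded {ι : Type*} {c : ι → ℕ → ℂ}
    (hc : ∀ i, Summable fun j => ‖c i j‖)
    (h : ∀ a : BoundedContinuousFunction ℕ ℂ, ∃ C : ℝ, ∀ i, ‖∑' j, a j * c i j‖ ≤ C) :
    ∃ M : ℝ, ∀ i j, ‖c i j‖ ≤ M := by
  have hbd : ∀ i (a : BoundedContinuousFunction ℕ ℂ) j, ‖a j * c i j‖ ≤ ‖a‖ * ‖c i j‖ :=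
    fun i a j => by
      rw [norm_mul]
      exact mul_le_mul_of_nonneg_right (a.norm_coe_le_norm j) (norm_nonneg _)
  have hs : ∀ i (a : BoundedContinuousFunction ℕ ℂ), Summable fun j => a j * c i j := fun i a =>
    Summable.of_norm_bounded ((hc i).mul_left ‖a‖) (hbd i a)
  let T : ι → BoundedContinuousFunction ℕ ℂ →L[ℂ] ℂ := fun i =>
    LinearMap.mkContinuous
      { toFun := fun a => ∑' j, a j * c i j
        map_add' := fun a b => by
          rw [← (hs i a).tsum_add (hs i b)]
          simp [add_mul]
        map_smul' := fun m a => by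
          simp [mul_assoc, tsum_mul_left] } (∑' j, ‖c i j‖) fun a => by
      rw [mul_comm, ← tsum_mul_left]
      exact tsum_of_norm_bounded ((hc i).mul_left ‖a‖).hasSum (hbd i a)
  have hT : ∀ i a, T i a = ∑' j, a j * c i j := fun i a => rfl
  obtain ⟨M, hM⟩ := banach_steinhaus (g := T) h
  refine ⟨M, fun i m => ?_⟩
  let e : BoundedContinuousFunction ℕ ℂ := BoundedContinuousFunction.ofNormedAddCommGroupDiscrete
    (fun j => if j = m then 1 else 0) 1 fun j => by split_ifs <;> simp
  have he : ‖e‖ ≤ 1 := BoundedContinuousFunction.norm_le zero_le_one |>.2 fun j => by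
    change ‖(if j = m then 1 else 0 : ℂ)‖ ≤ 1
    split_ifs <;> simp
  have hTe : T i e = c i m := by
    rw [hT, tsum_eq_single m fun j hj => by
      change (if j = m then 1 else 0 : ℂ) * c i j = 0
      simp [hj]]
    change (if m = m then 1 else 0 : ℂ) * c i m = c i m
    simp
  rw [← hTe]
  refine ((T i).le_opNorm e).trans ?_
  calc _ ≤ ‖T i‖ * 1 := by gcongr
    _ ≤ M := by rw [mul_one]; exact hM i

/-- If the model space consists of bounded functions, then `|θ|` tends to `1` at the unit circle:
otherwise some series of reproducing kernels would be an unbounded element of the model space. -/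
lemma tendstoUnimodular_of_kDisk_subset {p : ℝ} (hp : 1 < p) {θ : ℂ → ℂ} {θb : ℝ → ℂ}
    (hθ : InnerDisk θ θb) (hK : KDisk p θb ⊆ HinfDisk) : TendstoUnimodular θ := by
  obtain ⟨hd, hθ1, hθb, hlim⟩ := hθ
  have hp0 : 0 < p := by linarith
  intro ζ hζ
  by_contra hcon
  obtain ⟨δ, hδ, hfreq⟩ : ∃ δ < 1, ∃ᶠ z in 𝓝[Disk] ζ, ‖θ z‖ ≤ δ := by
    by_contra! hne
    refine hcon (tendsto_order.2 ⟨fun δ hδ => ?_, fun a ha => ?_⟩)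
    · simpa [Filter.Frequently] using hne δ hδ
    · filter_upwards [self_mem_nhdsWithin] with z hz using (hθ1 z hz).trans_lt ha
  have hex : ∀ j : ℕ, ∃ w, ‖θ w‖ ≤ δ ∧ w ∈ Disk ∧ ‖w - ζ‖ ≤ (1 / 8) ^ j ∧
      ∫⁻ t in Set.Ioc (0 : ℝ) (2 * Real.pi), ENNReal.ofReal
        ((4 ^ j * ((1 - ‖w‖) / ‖1 - (starRingEnd ℂ) w * Complex.exp (t * Complex.I)‖)) ^ p) ≤
        ENNReal.ofReal ((1 / 2) ^ j) := by
    intro j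
    have h1 : ∀ᶠ w in 𝓝[Disk] ζ, ‖w - ζ‖ ≤ (1 / 8) ^ j := by
      filter_upwards [mem_nhdsWithin_of_mem_nhds
        (Metric.closedBall_mem_nhds ζ (ε := (1 / 8) ^ j) (by positivity))] with w hw
      simpa [dist_eq_norm] using hw
    have h2 := (tendsto_lintegral_kernel hp0 hζ (c := 4 ^ j) (by positivity)).eventually_le_const
      (u := ENNReal.ofReal ((1 / 2) ^ j)) (by simp)
    exact (hfreq.and_eventually (eventually_mem_nhdsWithin.and (h1.and h2))).exists
  choose w hwδ hwD hwζ hwint using hex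
  have hw1 := fun j => mem_disk.1 (hwD j)
  have hd0 : ∀ j, 0 < 1 - ‖w j‖ := fun j => sub_pos.2 (hw1 j)
  set k : ℕ → ℂ → ℂ := fun j z =>
    (1 - (starRingEnd ℂ) (θ (w j)) * θ z) / (1 - (starRingEnd ℂ) (w j) * z) with hk
  have hkd : ∀ j, DifferentiableOn ℂ (k j) Disk := fun j =>
    ((differentiableOn_const _).sub ((differentiableOn_const _).mul hd)).div (by fun_prop)
      fun z hz => one_sub_conj_mul_ne_zero (hw1 j) (mem_disk.1 hz).le
  have hk2 : ∀ j, ∀ z ∈ Disk, ‖k j z‖ ≤ 2 / ‖1 - (starRingEnd ℂ) (w j) * z‖ := by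
    intro j z hz
    rw [hk, norm_div]
    refine div_le_div_of_nonneg_right ((norm_sub_le _ _).trans ?_) (norm_nonneg _)
    rw [norm_one, norm_mul, RCLike.norm_conj]
    linarith [mul_le_one₀ (hθ1 _ (hwD j)) (norm_nonneg _) (hθ1 z hz)]
  have hklim : ∀ j, ∀ᵐ t : ℝ, radLim (k j) t ((1 - (starRingEnd ℂ) (θ (w j)) * θb t) /
      (1 - (starRingEnd ℂ) (w j) * Complex.exp (t * Complex.I))) := by
    intro j
    filter_upwards [hlim] with t ht
    have h1 := radLim_of_continuousAt (F := fun z => 1 - (starRingEnd ℂ) (w j) * z) (t := t)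
      (fun _ _ => rfl) (by fun_prop)
    exact (tendsto_const_nhds.sub (ht.const_mul _)).div h1
      (one_sub_conj_mul_ne_zero (hw1 j) (Complex.norm_exp_ofReal_mul_I t).le)
  set D : ℕ → ℂ := fun j => ((2 ^ j * (1 - ‖w j‖) : ℝ) : ℂ) with hD
  have hbdd : ∀ a : BoundedContinuousFunction ℕ ℂ, ∃ C : ℝ, ∀ z : Disk,
      ‖∑' j, a j * (D j * k j z)‖ ≤ C := by
    intro a
    have ha : ∀ j, ‖a j‖ ≤ ‖a‖ + 1 := fun j => (a.norm_coe_le_norm j).trans (by linarith)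
    have hF := hasHpBoundary_tsum_kernel hp0 hζ hwD hwζ hwint hkd hk2 hklim
      (by positivity : 0 < ‖a‖ + 1) ha
    have hG := hasHpBoundary_tsum_kernel hp0 hζ hwD hwζ hwint
      (k := fun j => dslope θ (w j)) (b := fun j => (starRingEnd ℂ) (a j))
      (fun j => (Complex.differentiableOn_dslope (isOpen_disk.mem_nhds (hwD j))).2 hd)
      (fun j z hz => norm_dslope_le_of_schwarz hd hθ1 (hwD j) hz)
      (fun j => hlim.mono fun t ht => radLim_dslope ht (hwD j))
      (by positivity : 0 < ‖a‖ + 1) (fun j => (RCLike.norm_conj _).trans_le (ha j))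
    obtain ⟨F, hFd, ⟨C, hC⟩, hFlim⟩ := hK ⟨⟨_, hF⟩, _, ⟨_, hG⟩, by
      filter_upwards [hθb] with t ht
      rw [Complex.conj_tsum, ← tsum_mul_left, ← tsum_mul_left]
      congr 1
      ext j
      have hee : (starRingEnd ℂ) (Complex.exp (t * Complex.I)) =
          Complex.exp (-(t * Complex.I)) := by
        rw [← Complex.exp_conj]; simp
      have he1 : Complex.exp (-(t * Complex.I)) * Complex.exp (t * Complex.I) = 1 := by
        rw [← Complex.exp_add]; simp
      have hne := one_sub_conj_mul_ne_zero (hw1 j) (Complex.norm_exp_ofReal_mul_I t).le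
      have hθθ : (starRingEnd ℂ) (θb t) * θb t = 1 := by
        rw [← Complex.normSq_eq_conj_mul_self, Complex.normSq_eq_norm_sq, ht]; simp
      simp only [map_mul, map_div₀, map_sub, Complex.conj_conj, Complex.conj_ofReal, hee]
      have hden : Complex.exp (-(t * Complex.I)) - (starRingEnd ℂ) (w j) =
          Complex.exp (-(t * Complex.I)) *
            (1 - (starRingEnd ℂ) (w j) * Complex.exp (t * Complex.I)) := by
        linear_combination (starRingEnd ℂ) (w j) * he1
      have hnum : (starRingEnd ℂ) (θb t) - (starRingEnd ℂ) (θ (w j)) =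
          (starRingEnd ℂ) (θb t) * (1 - (starRingEnd ℂ) (θ (w j)) * θb t) := by
        linear_combination (starRingEnd ℂ) (θ (w j)) * hθθ
      rw [hden, hnum]
      have hexp := Complex.exp_ne_zero (-(t * Complex.I))
      field_simp⟩
    have heq := hF.eqOn hp hp (hasHpBoundary_of_bounded hp0 hFd hC hFlim)
    exact ⟨C, fun z => (congrArg norm (heq z.2)).trans_le (hC z z.2)⟩
  have hsum : ∀ z : Disk, Summable fun j => ‖D j * k j z‖ := by
    intro z
    have hz1 := sub_pos.2 (mem_disk.1 z.2)
    refine Summable.of_nonneg_of_le (fun _ => norm_nonneg _) (fun j => ?_)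
      ((summable_geometric_of_lt_one (r := (1 / 4 : ℝ)) (by norm_num) (by norm_num)).mul_right
        (2 / (1 - ‖(z : ℂ)‖)))
    have h0 : 0 ≤ 2 ^ j * (1 - ‖w j‖) := mul_nonneg (by positivity) (hd0 j).le
    have h1 := norm_sub_norm_le ζ (w j)
    rw [hζ, norm_sub_rev] at h1
    have h2 := one_sub_norm_right_le (z := (z : ℂ)) (hw1 j).le
    rw [norm_mul, hD, Complex.norm_real, Real.norm_of_nonneg h0]
    calc _ ≤ 2 ^ j * (1 / 8 : ℝ) ^ j * (2 / (1 - ‖(z : ℂ)‖)) := by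
          refine mul_le_mul ?_ ((hk2 j z z.2).trans ?_) (norm_nonneg _) (by positivity)
          · exact mul_le_mul_of_nonneg_left (h1.trans (hwζ j)) (by positivity)
          · gcongr
      _ = _ := by rw [← mul_pow]; norm_num
  obtain ⟨M, hM⟩ := exists_norm_le_of_tsum_bounded hsum hbdd
  have hlow : ∀ m : ℕ, 2 ^ m * ((1 - δ ^ 2) / 2) ≤ M := by
    intro m
    refine le_trans ?_ (hM ⟨w m, hwD m⟩ m)
    have h0 : 0 ≤ 2 ^ m * (1 - ‖w m‖) := mul_nonneg (by positivity) (hd0 m).le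
    have hk0 : k m (w m) = (((1 - ‖θ (w m)‖ ^ 2) / (1 - ‖w m‖ ^ 2) : ℝ) : ℂ) := by
      simp only [hk, ← Complex.normSq_eq_conj_mul_self, Complex.normSq_eq_norm_sq]
      push_cast
      rfl
    have h3 := hd0 m
    have h4 : 0 < 1 - ‖w m‖ ^ 2 := by nlinarith [norm_nonneg (w m)]
    have h5 : ‖θ (w m)‖ ^ 2 ≤ δ ^ 2 := by gcongr; exact hwδ m
    have h6 : δ ^ 2 < 1 := by
      have := (norm_nonneg _).trans (hwδ m)
      nlinarith
    have h7 : 0 ≤ (1 - ‖θ (w m)‖ ^ 2) / (1 - ‖w m‖ ^ 2) := div_nonneg (by linarith) h4.le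
    rw [norm_mul, hD, hk0, Complex.norm_real, Complex.norm_real, Real.norm_of_nonneg h0,
      Real.norm_of_nonneg h7, mul_assoc]
    refine mul_le_mul_of_nonneg_left ?_ (by positivity)
    rw [← mul_div_assoc, div_le_div_iff₀ two_pos h4]
    nlinarith [mul_nonneg h3.le (sub_nonneg.2 h5), mul_nonneg h3.le (sub_nonneg.2 h6.le),
      mul_nonneg (mul_nonneg h3.le h3.le) (sub_nonneg.2 h6.le)]
  have h6 : 0 < (1 - δ ^ 2) / 2 := by
    have := (norm_nonneg _).trans (hwδ 0)
    nlinarith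
  obtain ⟨m, hm⟩ := pow_unbounded_of_one_lt (M / ((1 - δ ^ 2) / 2)) one_lt_two
  rw [div_lt_iff₀ h6] at hm
  exact (hlow m).not_gt hm

/-- for an inner function `θ` on the disk and `p ∈ (1,∞)`, the model
space `K_θ` is contained in `H_∞(𝔻)` if and only if `θ` is a finite Blaschke
product. -/
theorem stmt10 (p : ℝ) (hp : 1 < p) (θ : ℂ → ℂ) (θb : ℝ → ℂ)
    (hθ : InnerDisk θ θb) :
    KDisk p θb ⊆ HinfDisk ↔ FiniteBlaschke θ := by
  exact ⟨fun h => (tendstoUnimodular_of_kDisk_subset hp hθ h).finiteBlaschke hθ.1,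
    kDisk_subset_of_finiteBlaschke hp hθ⟩

end
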